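/- Let M ∈ ℝ be a deadline. Assume: p_i > 0 for every i ∈ J; every i ∈ J ∪ {s} has a directed path to t in A; and there exists σ ∈ Σ with (V,A_σ) acyclic and Q_Γ(σ) ≤ M. Call a quadruple (σ, f, x, h) feasible for (Φ_anch) if: σ ∈ {0,1}^P with σ_{ij} = 1 for all (i,j) ∈ A; f is a flow witness for σ; h ∈ {0,1}^J; and x = (x^γ_i)_{0 ≤ γ ≤ Γ, i ∈ V} has x^γ_i ≥ 0 for all γ, i and satisfies (a) x^γ_j − x^γ_i ≥ p_i − M(1−σ_{ij}) for all (i,j) ∈ P and 0 ≤ γ ≤ Γ; (b) x^γ_j − x^{γ+1}_i ≥ p_i + δ̂_i − M(1−σ_{ij}) for all (i,j) ∈ P and 0 ≤ γ < Γ; (c) x^Γ_t − x^γ_t ≥ 0 for all 0 ≤ γ < Γ; (d) x^Γ_j − x^γ_j ≥ −M(1−h_j) for all j ∈ J and 0 ≤ γ < Γ; (e) x^Γ_t ≤ M. Then max{ |H| : H ⊆ J such that there exist σ ∈ Σ and a schedule z of (V,A_σ,p) with z_t ≤ M and H ∪ {t} anchored with respect to z for the arc set A_σ } = max{ Σ_{j∈J}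 h_j : (σ,f,x,h) feasible for (Φ_anch) }, both maxima being attained. (This is the compact MIP reformulation of the Anchor-Robust RCPSP under budgeted uncertainty.) -/

import Mathlib

/-- `x` is a schedule of the precedence graph `(V, E, p)`. -/
def Schedule {V : Type*} (E : Set (V × V)) (p : V → ℝ) (x : V → ℝ) : Prop :=
  (∀ i, 0 ≤ x i) ∧ ∀ i j : V, (i, j) ∈ E → p i ≤ x j - x i

/-- `(α, E)` is acyclic: there is no closed walk of positive length along arcs of `E`. -/
def Acyclic {α : Type*} (E : Set (α × α)) : Prop :=
  ¬ ∃ (m : ℕ) (v : ℕ → α), 1 ≤ m ∧ v 0 = v m ∧ ∀ ℓ < m, (v ℓ, v (ℓ + 1)) ∈ E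

/-- There is a directed path (of positive length) from `a` to `b` along arcs of `E`. -/
def Reaches {α : Type*} (E : Set (α × α)) (a b : α) : Prop :=
  ∃ (m : ℕ) (v : ℕ → α), 1 ≤ m ∧ v 0 = a ∧ v m = b ∧ ∀ ℓ < m, (v ℓ, v (ℓ + 1)) ∈ E

/-- `δ` belongs to the budgeted uncertainty set with deviations `δhat` and budget `Γ`. -/
def InBudget {V : Type*} [DecidableEq V] (J : Finset V) (δhat : V → ℝ) (Γ : ℕ)
    (δ : V → ℝ) : Prop :=
  ∃ S : Finset V, S ⊆ J ∧ S.card ≤ Γ ∧ (∀ i ∈ S, δ i = δhat i) ∧ ∀ i, i ∉ S → δ i = 0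

/-- `H` is anchored with respect to the schedule `z` for arc set `E` and the budgeted
uncertainty set. -/
def Anchored {V : Type*} [DecidableEq V] (J : Finset V) (δhat : V → ℝ) (Γ : ℕ)
    (E : Set (V × V)) (p : V → ℝ) (z : V → ℝ) (H : Set V) : Prop :=
  ∀ δ : V → ℝ, InBudget J δhat Γ δ →
    ∃ zd : V → ℝ, Schedule E (fun i => p i + δ i) zd ∧ ∀ i ∈ H, zd i = z i

/-- The set of makespans `x t` of schedules of `(V, E, p)`. -/
def MakespanSet {V : Type*} (E : Set (V × V)) (p : V → ℝ) (t : V) : Set ℝ :=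
  { c | ∃ x : V → ℝ, Schedule E p x ∧ x t = c }

/-- The set of inner minima `min { x t : x schedule of (V,E,p+δ) }` over budgeted `δ`;
the worst-case makespan `Q_Γ(E)` is its greatest element. -/
def WorstCaseSet {V : Type*} [DecidableEq V] (J : Finset V) (δhat : V → ℝ) (Γ : ℕ)
    (E : Set (V × V)) (p : V → ℝ) (t : V) : Set ℝ :=
  { m | ∃ δ : V → ℝ, InBudget J δhat Γ δ ∧
      IsLeast (MakespanSet E (fun i => p i + δ i) t) m }

/-- `f` is a flow witness for `σ`. -/
def FlowWitness {V K : Type*} [Fintype V] [DecidableEq V]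
    (J : Finset V) (s t : V) (Kfin : Finset K) (r : V → K → ℝ)
    (σ : V × V → ℝ) (f : V × V → K → ℝ) : Prop :=
  (∀ i j : V, i ≠ j → ∀ k ∈ Kfin,
      0 ≤ f (i, j) k ∧ f (i, j) k ≤ min (r i k) (r j k) * σ (i, j)) ∧
  (∀ k ∈ Kfin, ∀ i : V, (i ∈ J ∨ i = s) →
      ∑ j ∈ Finset.univ.erase i, f (i, j) k = r i k) ∧
  (∀ k ∈ Kfin, ∀ i : V, (i ∈ J ∨ i = t) →
      ∑ j ∈ Finset.univ.erase i, f (j, i) k = r i k)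

/-- `σ ∈ Σ` is a sequencing decision: a `0/1` vector on `P = {(i,j) : i ≠ j}` containing
all arcs of `A` and admitting a flow witness. -/
def SeqDecision {V K : Type*} [Fintype V] [DecidableEq V]
    (J : Finset V) (s t : V) (A : Set (V × V)) (Kfin : Finset K) (r : V → K → ℝ)
    (σ : V × V → ℝ) : Prop :=
  (∀ i j : V, i ≠ j → σ (i, j) = 0 ∨ σ (i, j) = 1) ∧
  (∀ a ∈ A, σ a = 1) ∧
  ∃ f : V × V → K → ℝ, FlowWitness J s t Kfin r σ f

/-- The arc set `A_σ = {(i,j) ∈ P : σ_{ij} = 1}` induced by `σ`. -/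
def ASigma {V : Type*} (σ : V × V → ℝ) : Set (V × V) :=
  { a | a.1 ≠ a.2 ∧ σ a = 1 }

/-- `(σ, f, x, h)` is feasible for the compact reformulation `(Φ_anch)` of the
Anchor-Robust RCPSP with deadline (and big-M value) `M`. -/
def FeasQuad {V K : Type*} [Fintype V] [DecidableEq V]
    (J : Finset V) (s t : V) (A : Set (V × V)) (Kfin : Finset K) (r : V → K → ℝ)
    (p δhat : V → ℝ) (Γ : ℕ) (M : ℝ)
    (σ : V × V → ℝ) (f : V × V → K → ℝ) (x : ℕ → V → ℝ) (h : V → ℝ) : Prop :=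
  (∀ i j : V, i ≠ j → σ (i, j) = 0 ∨ σ (i, j) = 1) ∧
  (∀ a ∈ A, σ a = 1) ∧
  FlowWitness J s t Kfin r σ f ∧
  (∀ j ∈ J, h j = 0 ∨ h j = 1) ∧
  (∀ γ ≤ Γ, ∀ i, 0 ≤ x γ i) ∧
  (∀ γ ≤ Γ, ∀ i j : V, i ≠ j → p i - M * (1 - σ (i, j)) ≤ x γ j - x γ i) ∧
  (∀ γ < Γ, ∀ i j : V, i ≠ j →
      p i + δhat i - M * (1 - σ (i, j)) ≤ x γ j - x (γ + 1) i) ∧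
  (∀ γ < Γ, 0 ≤ x Γ t - x γ t) ∧
  (∀ j ∈ J, ∀ γ < Γ, -(M * (1 - h j)) ≤ x Γ j - x γ j) ∧
  x Γ t ≤ M

/-- The pointwise infimum of a nonempty family of schedules is a schedule. -/
theorem Schedule.pointwise_sInf {V : Type*} {E : Set (V × V)} {p : V → ℝ} {F : Set (V → ℝ)}
    (hne : F.Nonempty) (hF : ∀ x ∈ F, Schedule E p x) :
    Schedule E p (fun i => sInf ((fun x => x i) '' F)) := by
  have hbdd : ∀ i, BddBelow ((fun x : V → ℝ => x i) '' F) := fun i =>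
    ⟨0, by rintro _ ⟨x, hx, rfl⟩; exact (hF x hx).1 i⟩
  refine ⟨fun i => Real.sInf_nonneg ?_, fun i j hij => ?_⟩
  · rintro _ ⟨x, hx, rfl⟩
    exact (hF x hx).1 i
  · have h : p i + sInf ((fun x => x i) '' F) ≤ sInf ((fun x => x j) '' F) := by
      refine le_csInf (hne.image _) ?_
      rintro _ ⟨x, hx, rfl⟩
      have h1 := csInf_le (hbdd i) ⟨x, hx, rfl⟩
      have h2 := (hF x hx).2 i j hij
      dsimp only at h1 ⊢
      linarith
    dsimp only
    linarith

/-- A schedule for larger processing times is a schedule for smaller ones. -/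
theorem Schedule.mono {V : Type*} {E : Set (V × V)} {p q x : V → ℝ}
    (hx : Schedule E q x) (hpq : ∀ i, p i ≤ q i) : Schedule E p x :=
  ⟨hx.1, fun i j hij => (hpq i).trans (hx.2 i j hij)⟩

/-- Schedules are monotone along directed paths. -/
theorem Schedule.le_of_reaches {V : Type*} {E : Set (V × V)} {p x : V → ℝ}
    (hx : Schedule E p x) (hp : ∀ i, 0 ≤ p i) {a b : V} (hab : Reaches E a b) : x a ≤ x b := by
  obtain ⟨m, v, -, rfl, rfl, hv⟩ := hab
  have key : ∀ n ≤ m, x (v 0) ≤ x (v n) := by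
    intro n
    induction n with
    | zero => intro _; exact le_rfl
    | succ n ih =>
      intro hn
      have h1 := ih (by omega)
      have h2 := hx.2 _ _ (hv n (by omega))
      have h3 := hp (v n)
      linarith
  exact key m le_rfl

theorem Reaches.single {α : Type*} {E : Set (α × α)} {a b : α} (h : (a, b) ∈ E) :
    Reaches E a b :=
  ⟨1, fun n => if n = 0 then a else b, le_rfl, by simp, by simp, by simpa using h⟩

theorem Reaches.tail {α : Type*} {E : Set (α × α)} {a b c : α} (hab : Reaches E a b)
    (hbc : (b, c) ∈ E) : Reaches E a c := by
  obtain ⟨m, v, hm, rfl, rfl, hv⟩ := hab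
  refine ⟨m + 1, fun n => if n ≤ m then v n else c, by omega, by simp, by simp, ?_⟩
  intro ℓ hℓ
  rcases Nat.lt_or_ge ℓ m with h | h
  · simpa [h.le, Nat.succ_le_of_lt h] using hv ℓ h
  · obtain rfl : ℓ = m := by omega
    simpa using hbc

theorem Reaches.mono {α : Type*} {E F : Set (α × α)} (hEF : E ⊆ F) {a b : α}
    (h : Reaches E a b) : Reaches F a b := by
  obtain ⟨m, v, hm, ha, hb, hv⟩ := h
  exact ⟨m, v, hm, ha, hb, fun ℓ hℓ => hEF (hv ℓ hℓ)⟩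

theorem Acyclic.not_reaches_self {α : Type*} {E : Set (α × α)} (hE : Acyclic E) (a : α) :
    ¬ Reaches E a a := by
  rintro ⟨m, v, hm, h0, h1, hv⟩
  exact hE ⟨m, v, hm, h0.trans h1.symm, hv⟩

theorem Reaches.exists_first {α : Type*} {E : Set (α × α)} {a b : α} (h : Reaches E a b) :
    ∃ c, (a, c) ∈ E := by
  obtain ⟨m, v, hm, rfl, -, hv⟩ := h
  exact ⟨v 1, hv 0 hm⟩

/-- An acyclic precedence graph admits a schedule. -/
theorem Acyclic.exists_schedule {V : Type*} [Fintype V] [DecidableEq V] {E : Set (V × V)}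
    (hE : Acyclic E) {p : V → ℝ} (hp : ∀ i, 0 ≤ p i) : ∃ x, Schedule E p x := by
  classical
  refine ⟨fun j => ∑ i with Reaches E i j, p i, fun i => Finset.sum_nonneg fun i _ => hp i, ?_⟩
  intro i j hij
  have hi : i ∉ Finset.univ.filter (fun a => Reaches E a i) := by
    simpa using hE.not_reaches_self i
  have hsub : insert i (Finset.univ.filter (fun a => Reaches E a i)) ⊆
      Finset.univ.filter (fun a => Reaches E a j) := by
    intro a ha
    rw [Finset.mem_insert, Finset.mem_filter] at ha
    rw [Finset.mem_filter]
    refine ⟨Finset.mem_univ _, ?_⟩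
    rcases ha with rfl | ha
    · exact Reaches.single hij
    · exact ha.2.tail hij
  have h := Finset.sum_le_sum_of_subset_of_nonneg hsub (f := p) fun a _ _ => hp a
  rw [Finset.sum_insert hi] at h
  dsimp only
  linarith

theorem InBudget.nonneg {V : Type*} [DecidableEq V] {J : Finset V} {δhat δ : V → ℝ} {Γ : ℕ}
    (hδhat : ∀ i, 0 ≤ δhat i) (hδ : InBudget J δhat Γ δ) (i : V) : 0 ≤ δ i := by
  obtain ⟨S, -, -, h1, h0⟩ := hδ
  by_cases hi : i ∈ S
  · rw [h1 i hi]; exact hδhat i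
  · rw [h0 i hi]

/-- For an acyclic arc set in which `t` has no successor, `{t}` can be anchored at any date
`M` that bounds the worst-case makespan. -/
theorem exists_schedule_anchored_singleton {V : Type*} [Fintype V] [DecidableEq V]
    {J : Finset V} {t : V} {E : Set (V × V)} {p δhat : V → ℝ} {Γ : ℕ} {M q : ℝ}
    (hp : ∀ i, 0 ≤ p i) (hδhat : ∀ i, 0 ≤ δhat i) (hE : Acyclic E)
    (ht : ∀ j, (t, j) ∉ E)
    (hq : IsGreatest (WorstCaseSet J δhat Γ E p t) q) (hqM : q ≤ M) :
    ∃ z, Schedule E p z ∧ z t ≤ M ∧ Anchored J δhat Γ E p z {t} := by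
  have key : ∀ δ, InBudget J δhat Γ δ →
      ∃ x, Schedule E (fun i => p i + δ i) x ∧ x t = M := by
    intro δ hδ
    have hne : {x | Schedule E (fun i => p i + δ i) x}.Nonempty :=
      hE.exists_schedule fun i => add_nonneg (hp i) (hδ.nonneg hδhat i)
    have hinf := Schedule.pointwise_sInf hne fun x hx => hx
    set x := fun i => sInf ((fun x : V → ℝ => x i) '' {x | Schedule E (fun i => p i + δ i) x})
      with hx
    have hle : x t ≤ M := by
      refine le_trans (hq.2 ⟨δ, hδ, ⟨x, hinf, rfl⟩, ?_⟩) hqM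
      rintro _ ⟨y, hy, rfl⟩
      exact csInf_le ⟨0, by rintro _ ⟨w, hw, rfl⟩; exact hw.1 t⟩ ⟨y, hy, rfl⟩
    refine ⟨Function.update x t M, ⟨fun i => ?_, fun i j hij => ?_⟩, by simp⟩
    · by_cases hi : i = t
      · subst hi; simpa using (hinf.1 i).trans hle
      · simpa [hi] using hinf.1 i
    · have hi : i ≠ t := by rintro rfl; exact ht j hij
      have h := hinf.2 i j hij
      by_cases hj : j = t
      · subst hj; simp [hi]; linarith
      · simpa [hi, hj] using h
  obtain ⟨z, hz, hzt⟩ := key 0 ⟨∅, by simp, by simp, by simp, by simp⟩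
  refine ⟨z, by simpa using hz, hzt.le, fun δ hδ => ?_⟩
  obtain ⟨x, hx, hxt⟩ := key δ hδ
  exact ⟨x, hx, by simp [hxt, hzt]⟩

/-- If `H` is anchored, there are layered schedules, one for each remaining budget, which all
agree with the baseline on `H`. -/
theorem Anchored.exists_layers {V : Type*} [DecidableEq V] {J : Finset V} {δhat : V → ℝ}
    {Γ : ℕ} {E : Set (V × V)} {p z : V → ℝ} {H : Set V} (h : Anchored J δhat Γ E p z H)
    (hδhat : ∀ i, 0 ≤ δhat i) (hδJ : ∀ i, i ∉ J → δhat i = 0) :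
    ∃ x : ℕ → V → ℝ, (∀ γ, Schedule E p (x γ)) ∧
      (∀ γ < Γ, ∀ i j, (i, j) ∈ E → p i + δhat i ≤ x γ j - x (γ + 1) i) ∧
      ∀ γ, ∀ i ∈ H, x γ i = z i := by
  let d : Finset V → V → ℝ := fun S i => if i ∈ S then δhat i else 0
  let F : Finset V → Set (V → ℝ) := fun S =>
    {y | Schedule E (fun i => p i + d S i) y ∧ ∀ i ∈ H, y i = z i}
  have hd0 : ∀ S i, 0 ≤ d S i := by
    intro S i; dsimp only [d]; split_ifs; exacts [hδhat i, le_rfl]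
  have hdmono : ∀ S a i, d S i ≤ d (insert a S) i := by
    intro S a i
    by_cases hi : i ∈ S
    · simp [d, hi]
    · simpa [d, hi] using hd0 (insert a S) i
  have hFne : ∀ S, S ⊆ J → S.card ≤ Γ → (F S).Nonempty := fun S hS hc =>
    h (d S) ⟨S, hS, hc, fun i hi => by simp [d, hi], fun i hi => by simp [d, hi]⟩
  let w : Finset V → V → ℝ := fun S i => sInf ((fun y => y i) '' F S)
  have hw : ∀ S, S ⊆ J → S.card ≤ Γ → Schedule E (fun i => p i + d S i) (w S) :=
    fun S hS hc => Schedule.pointwise_sInf (hFne S hS hc) fun y hy => hy.1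
  have hwH : ∀ S, S ⊆ J → S.card ≤ Γ → ∀ i ∈ H, w S i = z i := by
    intro S hS hc i hi
    have : (fun y : V → ℝ => y i) '' F S = {z i} := by
      refine (Set.Nonempty.subset_singleton_iff ((hFne S hS hc).image _)).1 ?_
      rintro _ ⟨y, hy, rfl⟩
      exact hy.2 i hi
    simp [w, this]
  have hwmono : ∀ S a, insert a S ⊆ J → (insert a S).card ≤ Γ → ∀ i,
      w S i ≤ w (insert a S) i := by
    intro S a hS hc i
    refine csInf_le_csInf ⟨0, ?_⟩ ((hFne _ hS hc).image _) (Set.image_mono ?_)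
    · rintro _ ⟨y, hy, rfl⟩
      exact hy.1.1 i
    · exact fun y hy => ⟨hy.1.mono fun i => by have := hdmono S a i; linarith, hy.2⟩
  let B : ℕ → Finset (Finset V) := fun γ => J.powerset.filter fun S => S.card ≤ Γ - γ
  have hB : ∀ γ S, S ∈ B γ ↔ S ⊆ J ∧ S.card ≤ Γ - γ := by simp [B]
  have hBne : ∀ γ, (B γ).Nonempty := fun γ => ⟨∅, by simp [hB]⟩
  let x : ℕ → V → ℝ := fun γ i => (B γ).sup' (hBne γ) fun S => w S i
  have hle : ∀ γ S i, S ∈ B γ → w S i ≤ x γ i := fun γ S i hS =>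
    Finset.le_sup' (fun S => w S i) hS
  have hex : ∀ γ i, ∃ S, S ⊆ J ∧ S.card ≤ Γ - γ ∧ x γ i = w S i := by
    intro γ i
    obtain ⟨S, hS, he⟩ := Finset.exists_mem_eq_sup' (hBne γ) fun S => w S i
    exact ⟨S, ((hB γ S).1 hS).1, ((hB γ S).1 hS).2, he⟩
  refine ⟨x, fun γ => ⟨fun i => ?_, fun i j hij => ?_⟩, fun γ hγ i j hij => ?_,
    fun γ i hi => ?_⟩
  · obtain ⟨S, hS, hc, he⟩ := hex γ i
    rw [he]
    exact (hw S hS (by omega)).1 i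
  · obtain ⟨S, hS, hc, he⟩ := hex γ i
    have h1 := (hw S hS (by omega)).2 i j hij
    have h2 := hle γ S j ((hB _ _).2 ⟨hS, hc⟩)
    have h3 := hd0 S i
    dsimp only at h1
    linarith
  · obtain ⟨S, hS, hc, he⟩ := hex (γ + 1) i
    by_cases hi : i ∈ J
    · have hS' : insert i S ⊆ J := Finset.insert_subset hi hS
      have hc' : (insert i S).card ≤ Γ - γ := (Finset.card_insert_le i S).trans (by omega)
      have h1 := (hw _ hS' (by omega)).2 i j hij
      have h2 := hle γ _ j ((hB _ _).2 ⟨hS', hc'⟩)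
      have h3 := hwmono S i hS' (by omega) i
      have h4 : d (insert i S) i = δhat i := by simp [d]
      dsimp only at h1
      linarith
    · have h1 := (hw S hS (by omega)).2 i j hij
      have h2 := hle γ S j ((hB _ _).2 ⟨hS, by omega⟩)
      have h3 := hd0 S i
      rw [hδJ i hi]
      dsimp only at h1
      linarith
  · obtain ⟨S, hS, hc, he⟩ := hex γ i
    rw [he]
    exact hwH S hS (by omega) i hi

/-- Layered schedules in which no layer exceeds the last one on `H` make `H` anchored with
respect to the last layer. -/
theorem Anchored.of_layers {V : Type*} [DecidableEq V] {J : Finset V} {δhat : V → ℝ}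
    {Γ : ℕ} {E : Set (V × V)} {p : V → ℝ} {H : Set V} {x : ℕ → V → ℝ}
    (hp : ∀ i, 0 ≤ p i) (hpJ : ∀ i ∈ J, 0 < p i)
    (hx : ∀ γ ≤ Γ, Schedule E p (x γ))
    (hstep : ∀ γ < Γ, ∀ i j, (i, j) ∈ E → p i + δhat i ≤ x γ j - x (γ + 1) i)
    (hH : ∀ γ < Γ, ∀ i ∈ H, x γ i ≤ x Γ i) :
    Anchored J δhat Γ E p (x Γ) H := by
  rintro δ ⟨S, hSJ, hSc, hS1, hS0⟩
  let c : V → ℕ := fun j => (S.filter fun i => x Γ i < x Γ j).card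
  have hcΓ : ∀ j, c j ≤ Γ := fun j => (Finset.card_filter_le _ _).trans hSc
  have hcmono : ∀ i j, (i, j) ∈ E → c i ≤ c j := by
    intro i j hij
    have h := (hx Γ le_rfl).2 i j hij
    have h' := hp i
    refine Finset.card_le_card fun a ha => ?_
    rw [Finset.mem_filter] at ha ⊢
    exact ⟨ha.1, by linarith [ha.2]⟩
  have hcsucc : ∀ i j, (i, j) ∈ E → i ∈ S → c i + 1 ≤ c j := by
    intro i j hij hi
    have h := (hx Γ le_rfl).2 i j hij
    have h' := hpJ i (hSJ hi)
    refine Finset.card_lt_card ((Finset.ssubset_iff_of_subset fun a ha => ?_).2 ⟨i, ?_, ?_⟩)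
    · rw [Finset.mem_filter] at ha ⊢
      exact ⟨ha.1, by linarith [ha.2]⟩
    · rw [Finset.mem_filter]
      exact ⟨hi, by linarith⟩
    · simp
  let y : V → ℝ := fun j =>
    (Finset.range (c j + 1)).sup' Finset.nonempty_range_add_one fun k => x (Γ - k) j
  have hle : ∀ j k, k ≤ c j → x (Γ - k) j ≤ y j := fun j k hk =>
    Finset.le_sup' (fun k => x (Γ - k) j) (Finset.mem_range.2 (by omega))
  have hex : ∀ j, ∃ k ≤ c j, y j = x (Γ - k) j := by
    intro j
    obtain ⟨k, hk, he⟩ := Finset.exists_mem_eq_sup'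
      (Finset.nonempty_range_add_one (n := c j)) fun k => x (Γ - k) j
    exact ⟨k, by rw [Finset.mem_range] at hk; omega, he⟩
  refine ⟨y, ⟨fun i => ?_, fun i j hij => ?_⟩, fun i hi => le_antisymm ?_ ?_⟩
  · obtain ⟨k, -, he⟩ := hex i
    rw [he]
    exact (hx _ (Nat.sub_le _ _)).1 i
  · obtain ⟨k, hk, he⟩ := hex i
    by_cases hi : i ∈ S
    · have h1 := hcsucc i j hij hi
      have h2 := hcΓ j
      have h3 := hstep (Γ - (k + 1)) (by omega) i j hij
      rw [show Γ - (k + 1) + 1 = Γ - k by omega] at h3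
      have h4 := hle j (k + 1) (by omega)
      dsimp only
      rw [hS1 i hi]
      linarith
    · have h1 := hcmono i j hij
      have h3 := (hx (Γ - k) (Nat.sub_le _ _)).2 i j hij
      have h4 := hle j k (by omega)
      dsimp only
      rw [hS0 i hi]
      linarith
  · obtain ⟨k, -, he⟩ := hex i
    rw [he]
    rcases (Nat.sub_le Γ k).lt_or_eq with h | h
    · exact hH _ h i hi
    · rw [h]
  · exact hle i 0 (Nat.zero_le _)

/-- A nonempty set of natural numbers bounded above, viewed in `ℝ`, has a greatest element. -/
theorem exists_isGreatest_of_natCast {C : Set ℝ} {N : ℕ} (hne : C.Nonempty)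
    (hC : ∀ c ∈ C, ∃ n : ℕ, n ≤ N ∧ (n : ℝ) = c) : ∃ v, IsGreatest C v := by
  have hfin : C.Finite := by
    refine ((Set.finite_Iic N).image (Nat.cast : ℕ → ℝ)).subset fun c hc => ?_
    obtain ⟨n, hn, rfl⟩ := hC c hc
    exact ⟨n, hn, rfl⟩
  obtain ⟨v, hv, hmax⟩ := Set.exists_max_image C id hfin hne
  exact ⟨v, hv, hmax⟩

/-- Compact MIP reformulation `(Φ_anch)` of the Anchor-Robust RCPSP under budgeted
uncertainty: the maximum number of anchored jobs `|H|`, over `H ⊆ J`, sequencing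
decisions `σ ∈ Σ` and baseline schedules `z` of `(V, A_σ, p)` with `z t ≤ M` such that
`H ∪ {t}` is anchored w.r.t. `z` and `σ`, equals the maximum of `Σ_{j ∈ J} h j` over
feasible quadruples of `(Φ_anch)`, both maxima being attained. -/
theorem anchor_robust_compact_MIP {V K : Type*} [Fintype V] [DecidableEq V]
    (J : Finset V) (s t : V) (hst : s ≠ t) (hsJ : s ∉ J) (htJ : t ∉ J)
    (hV : ∀ v : V, v ∈ J ∨ v = s ∨ v = t)
    (p : V → ℝ) (hp : ∀ i, 0 ≤ p i) (hps : p s = 0) (hpt : p t = 0)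
    (hpJ : ∀ i ∈ J, 0 < p i)
    (δhat : V → ℝ) (hδhat : ∀ i, 0 ≤ δhat i) (hδs : δhat s = 0) (hδt : δhat t = 0)
    (Γ : ℕ)
    (A : Set (V × V)) (hAP : ∀ a ∈ A, a.1 ≠ a.2) (hA : Acyclic A)
    (hreach : ∀ i : V, (i ∈ J ∨ i = s) → Reaches A i t)
    (Kfin : Finset K) (R : K → ℝ) (hR : ∀ k ∈ Kfin, 0 ≤ R k)
    (r : V → K → ℝ) (hr : ∀ i ∈ J, ∀ k ∈ Kfin, 0 ≤ r i k)
    (hrs : ∀ k ∈ Kfin, r s k = R k) (hrt : ∀ k ∈ Kfin, r t k = R k)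
    (M : ℝ)
    (hex : ∃ σ : V × V → ℝ, SeqDecision J s t A Kfin r σ ∧ Acyclic (ASigma σ) ∧
      ∃ q : ℝ, IsGreatest (WorstCaseSet J δhat Γ (ASigma σ) p t) q ∧ q ≤ M) :
    ∃ v : ℝ,
      IsGreatest { c : ℝ | ∃ H : Finset V, H ⊆ J ∧
          (∃ σ : V × V → ℝ, SeqDecision J s t A Kfin r σ ∧
            ∃ z : V → ℝ, Schedule (ASigma σ) p z ∧ z t ≤ M ∧
              Anchored J δhat Γ (ASigma σ) p z ((↑H : Set V) ∪ {t})) ∧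
          (H.card : ℝ) = c } v ∧
      IsGreatest { c : ℝ | ∃ (σ : V × V → ℝ) (f : V × V → K → ℝ)
          (x : ℕ → V → ℝ) (h : V → ℝ),
          FeasQuad J s t A Kfin r p δhat Γ M σ f x h ∧ (∑ j ∈ J, h j) = c } v := by
  classical
  have hδJ : ∀ i, i ∉ J → δhat i = 0 := by
    intro i hi
    rcases hV i with h | rfl | rfl
    exacts [absurd h hi, hδs, hδt]
  have hAσ : ∀ σ : V × V → ℝ, (∀ a ∈ A, σ a = 1) → A ⊆ ASigma σ :=
    fun σ hσ a ha => ⟨hAP a ha, hσ a ha⟩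
  have hne : { c : ℝ | ∃ H : Finset V, H ⊆ J ∧
      (∃ σ : V × V → ℝ, SeqDecision J s t A Kfin r σ ∧
        ∃ z : V → ℝ, Schedule (ASigma σ) p z ∧ z t ≤ M ∧
          Anchored J δhat Γ (ASigma σ) p z ((↑H : Set V) ∪ {t})) ∧
      (H.card : ℝ) = c }.Nonempty := by
    obtain ⟨σ, hσ, hacyc, q, hq, hqM⟩ := hex
    have ht : ∀ j, (t, j) ∉ ASigma σ := by
      intro j hj
      have hjt : j ∈ J ∨ j = s := by
        rcases hV j with h | h | h
        exacts [Or.inl h, Or.inr h, absurd h.symm hj.1]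
      exact hacyc.not_reaches_self j (((hreach j hjt).mono (hAσ σ hσ.2.1)).tail hj)
    obtain ⟨z, hz, hzt, hanch⟩ :=
      exists_schedule_anchored_singleton hp hδhat hacyc ht hq hqM
    exact ⟨_, ∅, by simp, ⟨σ, hσ, z, hz, hzt, by simpa using hanch⟩, rfl⟩
  obtain ⟨v, hv⟩ := exists_isGreatest_of_natCast (N := J.card) hne (by
    rintro _ ⟨H, hHJ, -, rfl⟩
    exact ⟨_, Finset.card_le_card hHJ, rfl⟩)
  refine ⟨v, hv, ?_⟩
  convert hv using 1
  ext c
  constructor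
  · rintro ⟨σ, f, x, h, ⟨hσ, hσA, hf, hh, hx0, ha, hb, hc, hd, he⟩, rfl⟩
    refine ⟨J.filter fun j => h j = 1, Finset.filter_subset _ _, ⟨σ, ⟨hσ, hσA, f, hf⟩, x Γ, ?_⟩,
      ?_⟩
    · have hsched : ∀ γ ≤ Γ, Schedule (ASigma σ) p (x γ) := by
        refine fun γ hγ => ⟨hx0 γ hγ, fun i j hij => ?_⟩
        have := ha γ hγ i j hij.1
        rw [hij.2] at this
        linarith
      refine ⟨hsched Γ le_rfl, he, Anchored.of_layers hp hpJ hsched ?_ ?_⟩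
      · intro γ hγ i j hij
        have := hb γ hγ i j hij.1
        rw [hij.2] at this
        linarith
      · rintro γ hγ i (hi | hi)
        · rw [Finset.mem_coe, Finset.mem_filter] at hi
          have := hd i hi.1 γ hγ
          rw [hi.2] at this
          linarith
        · obtain rfl : i = t := hi
          linarith [hc γ hγ]
    · rw [Finset.card_filter, Nat.cast_sum]
      refine Finset.sum_congr rfl fun j hj => ?_
      rcases hh j hj with h0 | h1
      · simp [h0]
      · simp [h1]
  · rintro ⟨H, hHJ, ⟨σ, ⟨hσ, hσA, f, hf⟩, z, hz, hzt, hanch⟩, rfl⟩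
    obtain ⟨x, hx, hstep, hxH⟩ := hanch.exists_layers hδhat hδJ
    have hxt : ∀ γ, x γ t = z t := fun γ => hxH γ t (by simp)
    have hxM : ∀ γ i, x γ i ≤ M := by
      intro γ i
      rcases eq_or_ne i t with rfl | hi
      · rw [hxt]; exact hzt
      · have hi' : i ∈ J ∨ i = s := by
          rcases hV i with h | h | h
          exacts [Or.inl h, Or.inr h, absurd h hi]
        have h1 := (hx γ).le_of_reaches hp ((hreach i hi').mono (hAσ σ hσA))
        rw [hxt] at h1
        exact h1.trans hzt
    have hout : ∀ i, i = t ∨ ∃ j, (i, j) ∈ ASigma σ := by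
      intro i
      rcases hV i with h | h | h
      exacts [Or.inr ((hreach i (Or.inl h)).mono (hAσ σ hσA)).exists_first,
        Or.inr ((hreach i (Or.inr h)).mono (hAσ σ hσA)).exists_first, Or.inl h]
    refine ⟨σ, f, x, fun j => if j ∈ H then 1 else 0, ⟨hσ, hσA, hf, ?_, ?_, ?_, ?_, ?_, ?_, ?_⟩,
      ?_⟩
    · intro j _
      by_cases hj : j ∈ H <;> simp [hj]
    · exact fun γ _ => (hx γ).1
    · intro γ _ i j hij
      rcases hσ i j hij with h0 | h1
      · rw [h0]
        have hj := (hx γ).1 j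
        rcases hout i with rfl | ⟨l, hl⟩
        · linarith [hxM γ i]
        · linarith [hxM γ l, (hx γ).2 i l hl]
      · rw [h1]
        linarith [(hx γ).2 i j ⟨hij, h1⟩]
    · intro γ hγ i j hij
      rcases hσ i j hij with h0 | h1
      · rw [h0]
        have hj := (hx γ).1 j
        rcases hout i with rfl | ⟨l, hl⟩
        · linarith [hxM (γ + 1) i]
        · linarith [hxM γ l, hstep γ hγ i l hl]
      · rw [h1]
        linarith [hstep γ hγ i j ⟨hij, h1⟩]
    · intro γ _
      rw [hxt, hxt, sub_self]
    · intro j _ γ _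
      by_cases hj : j ∈ H
      · have hmem : j ∈ (↑H : Set V) ∪ {t} := Or.inl hj
        simp [hj, hxH _ j hmem]
      · simp only [hj, if_false]
        linarith [hxM γ j, (hx Γ).1 j]
    · rw [hxt]; exact hzt
    · rw [Finset.sum_ite_mem, Finset.inter_eq_right.2 hHJ]
      simp
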